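/- Continuous dependence for the regularized 2-1 junction: let {φ^1,φ^2,φ^3, f̄^1, f̄^2, Φ̄^3_f} and {ψ^1,ψ^2,ψ^3, ḡ^1, ḡ^2, Φ̄^3_g} be two sets of initial and boundary data for the regularized 2-1 junction system (with the same Φ, table of games, H_ε, p and T), and let F = (f^1,f^2,f^3), G = (g^1,g^2,g^3) be corresponding mild kinetic solutions. Then there exists C > 0 such that sup_{t∈[0,T]} Σ_{r=1}^3 Σ_{j=1}^n |g^r_j(t) − f^r_j(t)| ≤ C [ Σ_{r=1}^3 Σ_{j=1}^n |ψ^r_j − φ^r_j| + ∫_0^T ( Σ_{r=1}^2 |Φ̄^r_g(t) − Φ̄^r_f(t)| + |Φ̄^3_g(t) − Φ̄^3_f(t)| + Σ_{r=1}^2 Σ_{j=1}^n |ḡ^r_j(t) − f̄^r_j(t)| ) dt ], where Φ̄^r_f(t) = Φ(Σ_j f̄^r_j(t), Σ_j f^r_j(t)) and Φ̄^r_g(t) = Φ(Σ_j ḡ^r_j(t), Σ_j g^r_j(t)) for r = 1,2. -/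

import Mathlib

open Set

noncomputable def rhoF {n : ℕ} (f : Fin n → ℝ) : ℝ := ∑ j, f j

noncomputable def fluxF {n : ℕ} (v f : Fin n → ℝ) : ℝ := ∑ j, v j * f j

noncomputable def gainF {n : ℕ} (η0 : ℝ) (A : Fin n → Fin n → Fin n → ℝ → ℝ)
    (j : Fin n) (f : Fin n → ℝ) : ℝ :=
  η0 * rhoF f * ∑ h, ∑ k, A h k j (rhoF f) * f h * f k

noncomputable def lossF {n : ℕ} (η0 : ℝ) (f : Fin n → ℝ) : ℝ := η0 * (rhoF f) ^ 2

def admissibleF {n : ℕ} (f : Fin n → ℝ) : Prop :=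
  (∀ j, 0 ≤ f j ∧ f j ≤ 1) ∧ rhoF f ≤ 1

noncomputable def deltaC {n : ℕ} (j : Fin n) : ℝ := if (j : ℕ) = 0 then 0 else 1

def IsSpeedLattice {n : ℕ} (hn : 2 ≤ n) (v : Fin n → ℝ) : Prop :=
  StrictMono v ∧ v ⟨0, by omega⟩ = 0 ∧ v ⟨n - 1, by omega⟩ = 1

def IsFluxLimiter (Φ : ℝ → ℝ → ℝ) : Prop :=
  (∀ u ∈ Icc (0:ℝ) 1, ∀ w ∈ Icc (0:ℝ) 1, Φ u w ∈ Icc (0:ℝ) 1) ∧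
  (∀ u ∈ Icc (0:ℝ) 1, ∀ w ∈ Icc (0:ℝ) 1, 1 < u + w → Φ u w * u ≤ 1 - w) ∧
  (∃ K : ℝ, 0 < K ∧ ∀ u₁ ∈ Icc (0:ℝ) 1, ∀ w₁ ∈ Icc (0:ℝ) 1, ∀ u₂ ∈ Icc (0:ℝ) 1,
    ∀ w₂ ∈ Icc (0:ℝ) 1, |Φ u₂ w₂ - Φ u₁ w₁| ≤ K * (|u₂ - u₁| + |w₂ - w₁|))

def IsTableOfGames {n : ℕ} (A : Fin n → Fin n → Fin n → ℝ → ℝ) : Prop :=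
  (∀ h k j : Fin n, ∀ u ∈ Icc (0:ℝ) 1, A h k j u ∈ Icc (0:ℝ) 1) ∧
  (∀ h k : Fin n, ∀ u ∈ Icc (0:ℝ) 1, ∑ j, A h k j u = 1) ∧
  (∀ h k j : Fin n, ∃ K : ℝ, 0 < K ∧ ∀ u ∈ Icc (0:ℝ) 1, ∀ w ∈ Icc (0:ℝ) 1,
    |A h k j u - A h k j w| ≤ K * |u - w|)

def IsRegularizer (ε : ℝ) (H : ℝ → ℝ) : Prop :=
  (∀ x : ℝ, H x ∈ Icc (0:ℝ) 1) ∧ (∀ x : ℝ, x ≤ 0 → H x = 0) ∧ (∀ x : ℝ, ε ≤ x → H x = 1) ∧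
  ∃ K : ℝ, 0 < K ∧ ∀ x y : ℝ, |H x - H y| ≤ K * |x - y|

noncomputable def hcoef {n : ℕ} (v : Fin n → ℝ) (H : ℝ → ℝ) (p : ℝ)
    (f1 f2 : ℝ → Fin n → ℝ) (s : ℝ) : ℝ :=
  H (p - (fluxF v (f1 s) + fluxF v (f2 s)))

noncomputable def phi301 {n : ℕ} (v : Fin n → ℝ) (Φ : ℝ → ℝ → ℝ) (H : ℝ → ℝ) (p : ℝ)
    (f1 f2 f3 : ℝ → Fin n → ℝ) (s : ℝ) : ℝ :=
  Φ (∑ k, deltaC k * (f1 s k + hcoef v H p f1 f2 s * f2 s k)) (rhoF (f3 s))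

noncomputable def rhs21_1 {n : ℕ} (v : Fin n → ℝ) (η0 : ℝ) (A : Fin n → Fin n → Fin n → ℝ → ℝ)
    (Φ : ℝ → ℝ → ℝ) (H : ℝ → ℝ) (p : ℝ) (fbar1 f1 f2 f3 : ℝ → Fin n → ℝ)
    (j : Fin n) (s : ℝ) : ℝ :=
  v j * (Φ (∑ k, fbar1 s k) (rhoF (f1 s)) * fbar1 s j - phi301 v Φ H p f1 f2 f3 s * f1 s j)
  + gainF η0 A j (f1 s) - f1 s j * lossF η0 (f1 s)

noncomputable def rhs21_2 {n : ℕ} (v : Fin n → ℝ) (η0 : ℝ) (A : Fin n → Fin n → Fin n → ℝ → ℝ)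
    (Φ : ℝ → ℝ → ℝ) (H : ℝ → ℝ) (p : ℝ) (fbar2 f1 f2 f3 : ℝ → Fin n → ℝ)
    (j : Fin n) (s : ℝ) : ℝ :=
  v j * (Φ (∑ k, fbar2 s k) (rhoF (f2 s)) * fbar2 s j
    - hcoef v H p f1 f2 s * phi301 v Φ H p f1 f2 f3 s * f2 s j)
  + gainF η0 A j (f2 s) - f2 s j * lossF η0 (f2 s)

noncomputable def rhs21_3 {n : ℕ} (v : Fin n → ℝ) (η0 : ℝ) (A : Fin n → Fin n → Fin n → ℝ → ℝ)
    (Φ : ℝ → ℝ → ℝ) (H : ℝ → ℝ) (p : ℝ) (Φbar3 : ℝ → ℝ) (f1 f2 f3 : ℝ → Fin n → ℝ)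
    (j : Fin n) (s : ℝ) : ℝ :=
  v j * (phi301 v Φ H p f1 f2 f3 s * (f1 s j + hcoef v H p f1 f2 s * f2 s j) * deltaC j
    - Φbar3 s * f3 s j)
  + gainF η0 A j (f3 s) - f3 s j * lossF η0 (f3 s)

def IsMildSol21 {n : ℕ} (v : Fin n → ℝ) (η0 : ℝ) (A : Fin n → Fin n → Fin n → ℝ → ℝ)
    (Φ : ℝ → ℝ → ℝ) (H : ℝ → ℝ) (p T : ℝ) (φ1 φ2 φ3 : Fin n → ℝ)
    (fbar1 fbar2 : ℝ → Fin n → ℝ) (Φbar3 : ℝ → ℝ) (f1 f2 f3 : ℝ → Fin n → ℝ) : Prop :=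
  ContinuousOn f1 (Icc 0 T) ∧ ContinuousOn f2 (Icc 0 T) ∧ ContinuousOn f3 (Icc 0 T) ∧
  (∀ t ∈ Icc (0:ℝ) T, admissibleF (f1 t) ∧ admissibleF (f2 t) ∧ admissibleF (f3 t)) ∧
  (∀ t ∈ Icc (0:ℝ) T, ∀ j : Fin n,
    f1 t j = φ1 j + ∫ s in (0:ℝ)..t, rhs21_1 v η0 A Φ H p fbar1 f1 f2 f3 j s) ∧
  (∀ t ∈ Icc (0:ℝ) T, ∀ j : Fin n,
    f2 t j = φ2 j + ∫ s in (0:ℝ)..t, rhs21_2 v η0 A Φ H p fbar2 f1 f2 f3 j s) ∧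
  (∀ t ∈ Icc (0:ℝ) T, ∀ j : Fin n,
    f3 t j = φ3 j + ∫ s in (0:ℝ)..t, rhs21_3 v η0 A Φ H p Φbar3 f1 f2 f3 j s)

def GoodData21 {n : ℕ} (T : ℝ) (φ1 φ2 φ3 : Fin n → ℝ) (fbar1 fbar2 : ℝ → Fin n → ℝ)
    (Φbar3 : ℝ → ℝ) : Prop :=
  admissibleF φ1 ∧ admissibleF φ2 ∧ admissibleF φ3 ∧
  ContinuousOn fbar1 (Icc 0 T) ∧ (∀ t ∈ Icc (0:ℝ) T, admissibleF (fbar1 t)) ∧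
  ContinuousOn fbar2 (Icc 0 T) ∧ (∀ t ∈ Icc (0:ℝ) T, admissibleF (fbar2 t)) ∧
  ContinuousOn Φbar3 (Icc 0 T) ∧ (∀ t ∈ Icc (0:ℝ) T, Φbar3 t ∈ Icc (0:ℝ) 1)


/-- The `ℓ¹` distance between two state vectors. -/
noncomputable def l1Dist {n : ℕ} (f g : Fin n → ℝ) : ℝ := ∑ j, |g j - f j|

lemma l1Dist_nonneg {n : ℕ} (f g : Fin n → ℝ) : 0 ≤ l1Dist f g :=
  Finset.sum_nonneg fun _ _ => abs_nonneg _

lemma l1Dist_self {n : ℕ} (f : Fin n → ℝ) : l1Dist f f = 0 := by simp [l1Dist]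

lemma abs_sub_le_l1Dist {n : ℕ} (f g : Fin n → ℝ) (j : Fin n) : |g j - f j| ≤ l1Dist f g :=
  Finset.single_le_sum (f := fun j => |g j - f j|) (fun _ _ => abs_nonneg _) (Finset.mem_univ j)

lemma ContinuousOn.l1Dist {n : ℕ} {S : Set ℝ} {f g : ℝ → Fin n → ℝ} (hf : ContinuousOn f S)
    (hg : ContinuousOn g S) : ContinuousOn (fun s => l1Dist (f s) (g s)) S := by
  unfold _root_.l1Dist
  fun_prop

lemma abs_sum_mul_sub_le_l1Dist {n : ℕ} {w : Fin n → ℝ} (hw : ∀ j, w j ∈ Icc (0 : ℝ) 1)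
    (f g : Fin n → ℝ) : |∑ j, w j * g j - ∑ j, w j * f j| ≤ l1Dist f g := by
  rw [← Finset.sum_sub_distrib]
  refine (Finset.abs_sum_le_sum_abs _ _).trans (Finset.sum_le_sum fun j _ => ?_)
  rw [← mul_sub, abs_mul, abs_of_nonneg (hw j).1]
  exact mul_le_of_le_one_left (abs_nonneg _) (hw j).2

lemma abs_rhoF_sub_le {n : ℕ} (f g : Fin n → ℝ) : |rhoF g - rhoF f| ≤ l1Dist f g := by
  simpa [rhoF] using abs_sum_mul_sub_le_l1Dist (w := fun _ => 1) (by simp) f g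

lemma rhoF_mem {n : ℕ} {f : Fin n → ℝ} (hf : admissibleF f) : rhoF f ∈ Icc (0 : ℝ) 1 :=
  ⟨Finset.sum_nonneg fun j _ => (hf.1 j).1, hf.2⟩

/-- Multiplication on the unit interval is `1`-Lipschitz for the `ℓ¹` distance. -/
lemma abs_mul_sub_mul_le {a b a' b' x y : ℝ} (ha' : a' ∈ Icc (0 : ℝ) 1)
    (hb : b ∈ Icc (0 : ℝ) 1) (hx : |a' - a| ≤ x) (hy : |b' - b| ≤ y) :
    |a' * b' - a * b| ≤ x + y := by
  have h : a' * b' - a * b = (a' - a) * b + a' * (b' - b) := by ring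
  rw [h]
  refine (abs_add_le _ _).trans (add_le_add ?_ ?_)
  · rw [abs_mul, abs_of_nonneg hb.1]
    exact (mul_le_of_le_one_right (abs_nonneg _) hb.2).trans hx
  · rw [abs_mul, abs_of_nonneg ha'.1]
    exact (mul_le_of_le_one_left (abs_nonneg _) ha'.2).trans hy

lemma IsTableOfGames.exists_lipschitz {n : ℕ} {A : Fin n → Fin n → Fin n → ℝ → ℝ}
    (hA : IsTableOfGames A) : ∃ K : ℝ, 0 ≤ K ∧ ∀ h k j : Fin n, ∀ u ∈ Icc (0 : ℝ) 1,
      ∀ w ∈ Icc (0 : ℝ) 1, |A h k j u - A h k j w| ≤ K * |u - w| := by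
  choose K hK0 hK using hA.2.2
  refine ⟨∑ h, ∑ k, ∑ j, K h k j, Finset.sum_nonneg fun h _ => Finset.sum_nonneg fun k _ =>
    Finset.sum_nonneg fun j _ => (hK0 h k j).le, fun h k j u hu w hw => (hK h k j u hu w hw).trans
      (mul_le_mul_of_nonneg_right ?_ (abs_nonneg _))⟩
  calc K h k j ≤ ∑ j, K h k j :=
        Finset.single_le_sum (fun j _ => (hK0 h k j).le) (Finset.mem_univ j)
    _ ≤ ∑ k, ∑ j, K h k j :=
        Finset.single_le_sum (f := fun k => ∑ j, K h k j)
          (fun k _ => Finset.sum_nonneg fun j _ => (hK0 h k j).le) (Finset.mem_univ k)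
    _ ≤ ∑ h, ∑ k, ∑ j, K h k j :=
        Finset.single_le_sum (f := fun h => ∑ k, ∑ j, K h k j)
          (fun h _ => Finset.sum_nonneg fun k _ => Finset.sum_nonneg fun j _ => (hK0 h k j).le)
          (Finset.mem_univ h)

lemma exists_abs_gainF_sub_le {n : ℕ} {η0 : ℝ} (hη0 : 0 ≤ η0)
    {A : Fin n → Fin n → Fin n → ℝ → ℝ} (hA : IsTableOfGames A) :
    ∃ L : ℝ, 0 ≤ L ∧ ∀ (j : Fin n) (f g : Fin n → ℝ), admissibleF f → admissibleF g →
      |gainF η0 A j g - gainF η0 A j f| ≤ L * l1Dist f g := by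
  obtain ⟨K, hK0, hK⟩ := hA.exists_lipschitz
  refine ⟨η0 * (n * (n * (K + 3))), by positivity, fun j f g hf hg => ?_⟩
  have hterm : ∀ h k, |rhoF g * (A h k j (rhoF g) * g h * g k)
      - rhoF f * (A h k j (rhoF f) * f h * f k)| ≤ (K + 3) * l1Dist f g := fun h k => by
    have hAf := hA.1 h k j _ (rhoF_mem hf)
    have hAg := hA.1 h k j _ (rhoF_mem hg)
    have hAd : |A h k j (rhoF g) - A h k j (rhoF f)| ≤ K * l1Dist f g :=
      (hK h k j _ (rhoF_mem hg) _ (rhoF_mem hf)).trans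
        (mul_le_mul_of_nonneg_left (abs_rhoF_sub_le f g) hK0)
    have h1 := abs_mul_sub_mul_le hAg (hf.1 h) hAd (abs_sub_le_l1Dist f g h)
    have h2 := abs_mul_sub_mul_le (unitInterval.mul_mem hAg (hg.1 h)) (hf.1 k) h1
      (abs_sub_le_l1Dist f g k)
    have h3 := abs_mul_sub_mul_le (rhoF_mem hg)
      (unitInterval.mul_mem (unitInterval.mul_mem hAf (hf.1 h)) (hf.1 k)) (abs_rhoF_sub_le f g) h2
    linarith
  have heq : gainF η0 A j g - gainF η0 A j f = η0 * ∑ h, ∑ k,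
      (rhoF g * (A h k j (rhoF g) * g h * g k) - rhoF f * (A h k j (rhoF f) * f h * f k)) := by
    simp only [gainF, Finset.sum_sub_distrib, ← Finset.mul_sum]
    ring
  rw [heq, abs_mul, abs_of_nonneg hη0, mul_assoc]
  refine mul_le_mul_of_nonneg_left ?_ hη0
  calc _ ≤ ∑ h : Fin n, ∑ k : Fin n, (K + 3) * l1Dist f g :=
        (Finset.abs_sum_le_sum_abs _ _).trans (Finset.sum_le_sum fun h _ =>
          (Finset.abs_sum_le_sum_abs _ _).trans (Finset.sum_le_sum fun k _ => hterm h k))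
    _ = _ := by
        simp only [Finset.sum_const, Finset.card_univ, Fintype.card_fin, nsmul_eq_mul]
        ring

lemma abs_mul_lossF_sub_le {n : ℕ} {η0 : ℝ} (hη0 : 0 ≤ η0) (j : Fin n) {f g : Fin n → ℝ}
    (hf : admissibleF f) (hg : admissibleF g) :
    |g j * lossF η0 g - f j * lossF η0 f| ≤ 3 * η0 * l1Dist f g := by
  have h1 := abs_mul_sub_mul_le (rhoF_mem hg) (rhoF_mem hf) (abs_rhoF_sub_le f g)
    (abs_rhoF_sub_le f g)
  have h2 := abs_mul_sub_mul_le (hg.1 j) (unitInterval.mul_mem (rhoF_mem hf) (rhoF_mem hf))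
    (abs_sub_le_l1Dist f g j) h1
  have heq : g j * lossF η0 g - f j * lossF η0 f
      = η0 * (g j * (rhoF g * rhoF g) - f j * (rhoF f * rhoF f)) := by
    unfold lossF; ring
  rw [heq, abs_mul, abs_of_nonneg hη0]
  linarith [mul_le_mul_of_nonneg_left h2 hη0]

/-- Any right-hand side made of a transport term and the collision operator is Lipschitz in the
state vector, up to the variation of its fluxes. -/
lemma exists_abs_balance_sub_le {n : ℕ} {η0 : ℝ} (hη0 : 0 ≤ η0)
    {A : Fin n → Fin n → Fin n → ℝ → ℝ} (hA : IsTableOfGames A) :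
    ∃ L : ℝ, 0 ≤ L ∧ ∀ (j : Fin n) (f g : Fin n → ℝ), admissibleF f → admissibleF g →
      ∀ w ∈ Icc (0 : ℝ) 1, ∀ x y x' y' : ℝ,
      |(w * (x' - y') + gainF η0 A j g - g j * lossF η0 g)
        - (w * (x - y) + gainF η0 A j f - f j * lossF η0 f)|
        ≤ |x' - x| + |y' - y| + L * l1Dist f g := by
  obtain ⟨L, hL0, hL⟩ := exists_abs_gainF_sub_le hη0 hA
  refine ⟨L + 3 * η0, by positivity, fun j f g hf hg w hw x y x' y' => ?_⟩
  have h1 := hL j f g hf hg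
  have h2 := abs_mul_lossF_sub_le hη0 j hf hg
  have h3 : |w * (x' - y') - w * (x - y)| ≤ |x' - x| + |y' - y| := by
    rw [← mul_sub, abs_mul, abs_of_nonneg hw.1]
    refine (mul_le_of_le_one_left (abs_nonneg _) hw.2).trans ?_
    rw [show x' - y' - (x - y) = (x' - x) - (y' - y) by ring]
    exact abs_sub _ _
  rw [abs_le] at h1 h2 h3 ⊢
  constructor <;> linarith [h1.1, h1.2, h2.1, h2.2, h3.1, h3.2]

lemma IsSpeedLattice.mem_Icc {n : ℕ} {hn : 2 ≤ n} {v : Fin n → ℝ} (hv : IsSpeedLattice hn v)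
    (j : Fin n) : v j ∈ Icc (0 : ℝ) 1 :=
  ⟨hv.2.1 ▸ hv.1.monotone (Fin.mk_le_of_le_val (Nat.zero_le _)),
    hv.2.2 ▸ hv.1.monotone (Fin.le_def.2 (Nat.le_sub_one_of_lt j.2))⟩

lemma deltaC_mem_Icc {n : ℕ} (j : Fin n) : deltaC j ∈ Icc (0 : ℝ) 1 := by
  unfold deltaC
  split_ifs <;> simp

lemma abs_deltaC_mul_le {n : ℕ} (j : Fin n) (x : ℝ) : |deltaC j * x| ≤ |x| := by
  rw [abs_mul, abs_of_nonneg (deltaC_mem_Icc j).1]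
  exact mul_le_of_le_one_left (abs_nonneg _) (deltaC_mem_Icc j).2

/-- Below the threshold of the regularized priority rule, the flow offered to the outgoing road is
an admissible density. -/
lemma sum_deltaC_mem_Icc {n : ℕ} {hn : 2 ≤ n} {v : Fin n → ℝ} (hv : IsSpeedLattice hn v)
    {ε : ℝ} {H : ℝ → ℝ} (hH : IsRegularizer ε H) {p : ℝ} (hp0 : 0 < p)
    (hpv : ∀ k : Fin n, (k : ℕ) ≠ 0 → p ≤ v k) {f1 f2 : ℝ → Fin n → ℝ} {s : ℝ}
    (hf1 : admissibleF (f1 s)) (hf2 : admissibleF (f2 s)) :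
    ∑ k, deltaC k * (f1 s k + hcoef v H p f1 f2 s * f2 s k) ∈ Icc (0 : ℝ) 1 := by
  have hh : hcoef v H p f1 f2 s ∈ Icc (0 : ℝ) 1 := hH.1 _
  refine ⟨Finset.sum_nonneg fun k _ => mul_nonneg (deltaC_mem_Icc k).1
    (add_nonneg (hf1.1 k).1 (mul_nonneg hh.1 (hf2.1 k).1)), ?_⟩
  rcases le_or_gt (p - (fluxF v (f1 s) + fluxF v (f2 s))) 0 with hle | hgt
  · have h0 : hcoef v H p f1 f2 s = 0 := hH.2.1 _ hle
    simp only [h0, zero_mul, add_zero]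
    exact (Finset.sum_le_sum fun k _ =>
      mul_le_of_le_one_left (hf1.1 k).1 (deltaC_mem_Icc k).2).trans hf1.2
  · refine le_of_mul_le_mul_left ?_ hp0
    calc _ ≤ ∑ k, (v k * f1 s k + v k * f2 s k) := by
          rw [Finset.mul_sum]
          refine Finset.sum_le_sum fun k _ => ?_
          unfold deltaC
          split_ifs with hk
          · have := mul_nonneg (hv.mem_Icc k).1 (hf1.1 k).1
            have := mul_nonneg (hv.mem_Icc k).1 (hf2.1 k).1
            linarith
          · have h1 : f1 s k + hcoef v H p f1 f2 s * f2 s k ≤ f1 s k + f2 s k :=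
              add_le_add_right (mul_le_of_le_one_left (hf2.1 k).1 hh.2) _
            have h2 : 0 ≤ f1 s k + f2 s k := add_nonneg (hf1.1 k).1 (hf2.1 k).1
            rw [one_mul, ← mul_add]
            exact (mul_le_mul_of_nonneg_left h1 hp0.le).trans
              (mul_le_mul_of_nonneg_right (hpv k hk) h2)
      _ = fluxF v (f1 s) + fluxF v (f2 s) := Finset.sum_add_distrib
      _ ≤ _ := by linarith

lemma gronwall_integral {D : ℝ → ℝ} {T K L : ℝ} (hL : 0 < L) (hD : ContinuousOn D (Icc 0 T))
    (hD0 : ∀ t ∈ Icc 0 T, 0 ≤ D t)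
    (hle : ∀ t ∈ Icc 0 T, D t ≤ K + L * ∫ s in (0 : ℝ)..t, D s) :
    ∀ t ∈ Icc 0 T, D t ≤ K * Real.exp (L * t) := by
  intro t ht
  have hsub : ∀ {x}, x ∈ Icc 0 T → Icc 0 x ⊆ Icc 0 T := fun hx => Icc_subset_Icc_right hx.2
  have hnn : ∀ x ∈ Icc 0 T, 0 ≤ ∫ s in (0 : ℝ)..x, D s := fun x hx =>
    intervalIntegral.integral_nonneg hx.1 fun u hu => hD0 u (hsub hx hu)
  have hint : IntervalIntegrable D MeasureTheory.volume 0 T :=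
    (hD.mono (uIcc_of_le (ht.1.trans ht.2)).le).intervalIntegrable
  have key := norm_le_gronwallBound_of_norm_deriv_right_le
    (f := fun x => ∫ s in (0 : ℝ)..x, D s) (f' := D) (δ := 0) (K := L) (ε := K) (a := 0) (b := T)
    (by
      have := intervalIntegral.continuousOn_primitive_interval' hint left_mem_uIcc
      rwa [uIcc_of_le (ht.1.trans ht.2)] at this)
    (fun x hx => by
      have hx' : x ∈ Icc 0 T := Ico_subset_Icc_self hx
      have hcw : ContinuousWithinAt D (Ici x) x :=
        ((hD x hx').mono (Icc_subset_Icc_left hx.1)).mono_of_mem_nhdsWithin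
          (Icc_mem_nhdsGE hx.2)
      refine intervalIntegral.integral_hasDerivWithinAt_right
        (hD.mono ((uIcc_of_le hx.1).le.trans (hsub hx'))).intervalIntegrable ?_
        (hcw.mono Ioi_subset_Ici_self)
      exact ⟨Ioc x T, Ioc_mem_nhdsGT hx.2, (hD.mono (Ioc_subset_Icc_self.trans
        (Icc_subset_Icc_left hx.1))).aestronglyMeasurable measurableSet_Ioc⟩)
    (by simp)
    (fun x hx => by
      have hx' : x ∈ Icc 0 T := Ico_subset_Icc_self hx
      rw [Real.norm_of_nonneg (hD0 x hx'), Real.norm_of_nonneg (hnn x hx'), add_comm]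
      exact hle x hx') t ht
  rw [Real.norm_of_nonneg (hnn t ht), gronwallBound_of_K_ne_0 hL.ne'] at key
  have h2 := mul_le_mul_of_nonneg_left key hL.le
  have h3 : L * (0 * Real.exp (L * (t - 0)) + K / L * (Real.exp (L * (t - 0)) - 1))
      = K * Real.exp (L * t) - K := by
    rw [sub_zero]; field_simp; ring
  linarith [hle t ht]

/-- Comparison of two integral equations in integrated form. -/
lemma abs_sub_le_of_integral_eq {R S e : ℝ → ℝ} {a b x y T t : ℝ} (ht : t ∈ Icc 0 T)
    (hx : x = a + ∫ s in (0 : ℝ)..t, R s) (hy : y = b + ∫ s in (0 : ℝ)..t, S s)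
    (hR : ContinuousOn R (Icc 0 T)) (hS : ContinuousOn S (Icc 0 T)) (he : ContinuousOn e (Icc 0 T))
    (hle : ∀ s ∈ Icc 0 T, |S s - R s| ≤ e s) :
    |y - x| ≤ |b - a| + ∫ s in (0 : ℝ)..t, e s := by
  have hsub : uIcc 0 t ⊆ Icc 0 T := (uIcc_of_le ht.1).le.trans (Icc_subset_Icc_right ht.2)
  have hRi := (hR.mono hsub).intervalIntegrable (μ := MeasureTheory.volume)
  have hSi := (hS.mono hsub).intervalIntegrable (μ := MeasureTheory.volume)
  have hei := (he.mono hsub).intervalIntegrable (μ := MeasureTheory.volume)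
  have heq : y - x = (b - a) + ∫ s in (0 : ℝ)..t, (S s - R s) := by
    rw [intervalIntegral.integral_sub hSi hRi, hx, hy]; ring
  rw [heq]
  refine (abs_add_le _ _).trans (add_le_add_right ?_ _)
  refine (intervalIntegral.abs_integral_le_integral_abs ht.1).trans ?_
  exact intervalIntegral.integral_mono_on ht.1 (hSi.sub hRi).abs hei
    fun s hs => hle s (hsub ((uIcc_of_le ht.1).ge hs))

lemma continuousOn_of_abs_sub_le {u : ℝ → ℝ} {S : Set ℝ} (m : ℝ → ℝ → ℝ)
    (hm : ∀ s ∈ S, ContinuousOn (m s) S) (hm0 : ∀ s ∈ S, m s s = 0)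
    (hle : ∀ s ∈ S, ∀ s' ∈ S, |u s' - u s| ≤ m s s') : ContinuousOn u S := by
  intro s hs
  have h0 := hm s hs s hs
  rw [ContinuousWithinAt, hm0 s hs] at h0
  refine tendsto_iff_dist_tendsto_zero.2
    (squeeze_zero' (Filter.Eventually.of_forall fun _ => dist_nonneg) ?_ h0)
  filter_upwards [self_mem_nhdsWithin] with s' hs'
  rw [Real.dist_eq]
  exact hle s hs s' hs'

/-- The `ℓ¹` distance between the states of two junctions, each at its own time. -/
noncomputable def junctionDist {n : ℕ} (f1 f2 f3 g1 g2 g3 : ℝ → Fin n → ℝ) (s s' : ℝ) : ℝ :=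
  l1Dist (f1 s) (g1 s') + l1Dist (f2 s) (g2 s') + l1Dist (f3 s) (g3 s')

/-- The distance between the boundary data of two junctions, each at its own time. -/
noncomputable def boundaryDist {n : ℕ} (Φ : ℝ → ℝ → ℝ) (fbar1 fbar2 f1 f2 : ℝ → Fin n → ℝ)
    (Φbar3f : ℝ → ℝ) (gbar1 gbar2 g1 g2 : ℝ → Fin n → ℝ) (Φbar3g : ℝ → ℝ) (s s' : ℝ) : ℝ :=
  |Φ (∑ k, gbar1 s' k) (rhoF (g1 s')) - Φ (∑ k, fbar1 s k) (rhoF (f1 s))|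
    + |Φ (∑ k, gbar2 s' k) (rhoF (g2 s')) - Φ (∑ k, fbar2 s k) (rhoF (f2 s))|
    + |Φbar3g s' - Φbar3f s|
    + l1Dist (fbar1 s) (gbar1 s') + l1Dist (fbar2 s) (gbar2 s')

/-- The priority coefficient and the limiter of the outgoing road are Lipschitz in the state. -/
lemma exists_abs_hcoef_phi301_sub_le {n : ℕ} {hn : 2 ≤ n} {v : Fin n → ℝ}
    (hv : IsSpeedLattice hn v) {Φ : ℝ → ℝ → ℝ} (hΦ : IsFluxLimiter Φ)
    {ε : ℝ} {H : ℝ → ℝ} (hH : IsRegularizer ε H) {p : ℝ} (hp0 : 0 < p)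
    (hpv : ∀ k : Fin n, (k : ℕ) ≠ 0 → p ≤ v k) :
    ∃ L : ℝ, 0 ≤ L ∧ ∀ (f1 f2 f3 g1 g2 g3 : ℝ → Fin n → ℝ) (s s' : ℝ),
      admissibleF (f1 s) → admissibleF (f2 s) → admissibleF (f3 s) →
      admissibleF (g1 s') → admissibleF (g2 s') → admissibleF (g3 s') →
      |hcoef v H p g1 g2 s' - hcoef v H p f1 f2 s|
          ≤ L * junctionDist f1 f2 f3 g1 g2 g3 s s' ∧
        |phi301 v Φ H p g1 g2 g3 s' - phi301 v Φ H p f1 f2 f3 s|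
          ≤ L * junctionDist f1 f2 f3 g1 g2 g3 s s' := by
  obtain ⟨KΦ, hKΦ0, hKΦ⟩ := hΦ.2.2
  obtain ⟨KH, hKH0, hKH⟩ := hH.2.2.2
  refine ⟨KH + KΦ * (n * KH + 1), by positivity,
    fun f1 f2 f3 g1 g2 g3 s s' hf1 hf2 hf3 hg1 hg2 hg3 => ?_⟩
  have hd1 := l1Dist_nonneg (f1 s) (g1 s')
  have hd2 := l1Dist_nonneg (f2 s) (g2 s')
  have hd3 := l1Dist_nonneg (f3 s) (g3 s')
  have hD0 : 0 ≤ junctionDist f1 f2 f3 g1 g2 g3 s s' := by unfold junctionDist; positivity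
  have hh : |hcoef v H p g1 g2 s' - hcoef v H p f1 f2 s|
      ≤ KH * junctionDist f1 f2 f3 g1 g2 g3 s s' := by
    refine (hKH _ _).trans (mul_le_mul_of_nonneg_left ?_ hKH0.le)
    have h1 := abs_sum_mul_sub_le_l1Dist hv.mem_Icc (f1 s) (g1 s')
    have h2 := abs_sum_mul_sub_le_l1Dist hv.mem_Icc (f2 s) (g2 s')
    unfold junctionDist fluxF
    rw [abs_le] at h1 h2 ⊢
    constructor <;> linarith [h1.1, h1.2, h2.1, h2.2]
  have hU : |∑ k, deltaC k * (g1 s' k + hcoef v H p g1 g2 s' * g2 s' k)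
      - ∑ k, deltaC k * (f1 s k + hcoef v H p f1 f2 s * f2 s k)|
      ≤ l1Dist (f1 s) (g1 s') + n * (KH * junctionDist f1 f2 f3 g1 g2 g3 s s')
        + l1Dist (f2 s) (g2 s') := by
    have hc : (n : ℝ) * (KH * junctionDist f1 f2 f3 g1 g2 g3 s s')
        = ∑ _k : Fin n, KH * junctionDist f1 f2 f3 g1 g2 g3 s s' := by simp
    rw [hc, l1Dist, l1Dist, ← Finset.sum_add_distrib, ← Finset.sum_add_distrib,
      ← Finset.sum_sub_distrib]
    refine (Finset.abs_sum_le_sum_abs _ _).trans (Finset.sum_le_sum fun k _ => ?_)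
    rw [← mul_sub]
    refine (abs_deltaC_mul_le k _).trans ?_
    rw [add_sub_add_comm, add_assoc]
    exact (abs_add_le _ _).trans
      (add_le_add_right (abs_mul_sub_mul_le (hH.1 _) (hf2.1 k) hh le_rfl) _)
  have hφ := (hKΦ _ (sum_deltaC_mem_Icc hv hH hp0 hpv hf1 hf2) _ (rhoF_mem hf3) _
    (sum_deltaC_mem_Icc hv hH hp0 hpv hg1 hg2) _ (rhoF_mem hg3)).trans
    (mul_le_mul_of_nonneg_left (add_le_add hU (abs_rhoF_sub_le (f3 s) (g3 s'))) hKΦ0.le)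
  constructor
  · refine hh.trans (mul_le_mul_of_nonneg_right ?_ hD0)
    have : 0 ≤ KΦ * (n * KH + 1) := by positivity
    linarith
  · refine hφ.trans ?_
    have : 0 ≤ KH * junctionDist f1 f2 f3 g1 g2 g3 s s' := by positivity
    calc _ = KΦ * (n * KH + 1) * junctionDist f1 f2 f3 g1 g2 g3 s s' := by
          rw [show l1Dist (f1 s) (g1 s') + n * (KH * junctionDist f1 f2 f3 g1 g2 g3 s s')
            + l1Dist (f2 s) (g2 s') + l1Dist (f3 s) (g3 s')
            = n * (KH * junctionDist f1 f2 f3 g1 g2 g3 s s')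
              + junctionDist f1 f2 f3 g1 g2 g3 s s' by unfold junctionDist; ring]
          ring
      _ ≤ _ := by linarith

/-- The right-hand sides of the junction system are Lipschitz in the states and the data. -/
lemma exists_abs_rhs21_sub_le {n : ℕ} {hn : 2 ≤ n} {v : Fin n → ℝ} (hv : IsSpeedLattice hn v)
    {η0 : ℝ} (hη0 : 0 ≤ η0) {A : Fin n → Fin n → Fin n → ℝ → ℝ} (hA : IsTableOfGames A)
    {Φ : ℝ → ℝ → ℝ} (hΦ : IsFluxLimiter Φ) {ε : ℝ} {H : ℝ → ℝ} (hH : IsRegularizer ε H)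
    {p : ℝ} (hp0 : 0 < p) (hpv : ∀ k : Fin n, (k : ℕ) ≠ 0 → p ≤ v k) :
    ∃ L : ℝ, 0 < L ∧ ∀ (fbar1 fbar2 f1 f2 f3 gbar1 gbar2 g1 g2 g3 : ℝ → Fin n → ℝ)
      (Φbar3f Φbar3g : ℝ → ℝ) (s s' : ℝ) (j : Fin n),
      admissibleF (f1 s) → admissibleF (f2 s) → admissibleF (f3 s) →
      admissibleF (g1 s') → admissibleF (g2 s') → admissibleF (g3 s') →
      admissibleF (fbar1 s) → admissibleF (fbar2 s) →
      admissibleF (gbar1 s') → admissibleF (gbar2 s') →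
      Φbar3g s' ∈ Icc (0 : ℝ) 1 →
      |rhs21_1 v η0 A Φ H p gbar1 g1 g2 g3 j s' - rhs21_1 v η0 A Φ H p fbar1 f1 f2 f3 j s|
          ≤ L * junctionDist f1 f2 f3 g1 g2 g3 s s'
            + boundaryDist Φ fbar1 fbar2 f1 f2 Φbar3f gbar1 gbar2 g1 g2 Φbar3g s s' ∧
        |rhs21_2 v η0 A Φ H p gbar2 g1 g2 g3 j s' - rhs21_2 v η0 A Φ H p fbar2 f1 f2 f3 j s|
          ≤ L * junctionDist f1 f2 f3 g1 g2 g3 s s'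
            + boundaryDist Φ fbar1 fbar2 f1 f2 Φbar3f gbar1 gbar2 g1 g2 Φbar3g s s' ∧
        |rhs21_3 v η0 A Φ H p Φbar3g g1 g2 g3 j s' - rhs21_3 v η0 A Φ H p Φbar3f f1 f2 f3 j s|
          ≤ L * junctionDist f1 f2 f3 g1 g2 g3 s s'
            + boundaryDist Φ fbar1 fbar2 f1 f2 Φbar3f gbar1 gbar2 g1 g2 Φbar3g s s' := by
  obtain ⟨Lc, hLc0, hLc⟩ := exists_abs_balance_sub_le hη0 hA
  obtain ⟨Lp, hLp0, hLp⟩ := exists_abs_hcoef_phi301_sub_le hv hΦ hH hp0 hpv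
  refine ⟨Lc + 3 * Lp + 1, by positivity, fun fbar1 fbar2 f1 f2 f3 gbar1 gbar2 g1 g2 g3 Φf Φg
    s s' j hf1 hf2 hf3 hg1 hg2 hg3 hfb1 hfb2 hgb1 hgb2 hΦg => ?_⟩
  obtain ⟨hh, hφ⟩ := hLp f1 f2 f3 g1 g2 g3 s s' hf1 hf2 hf3 hg1 hg2 hg3
  have hhg : hcoef v H p g1 g2 s' ∈ Icc (0 : ℝ) 1 := hH.1 _
  have hhf : hcoef v H p f1 f2 s ∈ Icc (0 : ℝ) 1 := hH.1 _
  have hφg : phi301 v Φ H p g1 g2 g3 s' ∈ Icc (0 : ℝ) 1 :=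
    hΦ.1 _ (sum_deltaC_mem_Icc hv hH hp0 hpv hg1 hg2) _ (rhoF_mem hg3)
  have hφf : phi301 v Φ H p f1 f2 f3 s ∈ Icc (0 : ℝ) 1 :=
    hΦ.1 _ (sum_deltaC_mem_Icc hv hH hp0 hpv hf1 hf2) _ (rhoF_mem hf3)
  have hd1 := l1Dist_nonneg (f1 s) (g1 s')
  have hd2 := l1Dist_nonneg (f2 s) (g2 s')
  have hd3 := l1Dist_nonneg (f3 s) (g3 s')
  have hb1 := l1Dist_nonneg (fbar1 s) (gbar1 s')
  have hb2 := l1Dist_nonneg (fbar2 s) (gbar2 s')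
  have hD : junctionDist f1 f2 f3 g1 g2 g3 s s'
      = l1Dist (f1 s) (g1 s') + l1Dist (f2 s) (g2 s') + l1Dist (f3 s) (g3 s') := rfl
  have hB : boundaryDist Φ fbar1 fbar2 f1 f2 Φf gbar1 gbar2 g1 g2 Φg s s'
      = |Φ (∑ k, gbar1 s' k) (rhoF (g1 s')) - Φ (∑ k, fbar1 s k) (rhoF (f1 s))|
        + |Φ (∑ k, gbar2 s' k) (rhoF (g2 s')) - Φ (∑ k, fbar2 s k) (rhoF (f2 s))|
        + |Φg s' - Φf s| + l1Dist (fbar1 s) (gbar1 s') + l1Dist (fbar2 s) (gbar2 s') := rfl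
  have ha1 := abs_nonneg
    (Φ (∑ k, gbar1 s' k) (rhoF (g1 s')) - Φ (∑ k, fbar1 s k) (rhoF (f1 s)))
  have ha2 := abs_nonneg
    (Φ (∑ k, gbar2 s' k) (rhoF (g2 s')) - Φ (∑ k, fbar2 s k) (rhoF (f2 s)))
  have ha3 := abs_nonneg (Φg s' - Φf s)
  set D := junctionDist f1 f2 f3 g1 g2 g3 s s'
  set B := boundaryDist Φ fbar1 fbar2 f1 f2 Φf gbar1 gbar2 g1 g2 Φg s s'
  have hLpD : 0 ≤ Lp * D := mul_nonneg hLp0 (by linarith)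
  have hc1 : Lc * l1Dist (f1 s) (g1 s') ≤ Lc * D :=
    mul_le_mul_of_nonneg_left (by linarith) hLc0
  have hc2 : Lc * l1Dist (f2 s) (g2 s') ≤ Lc * D :=
    mul_le_mul_of_nonneg_left (by linarith) hLc0
  have hc3 : Lc * l1Dist (f3 s) (g3 s') ≤ Lc * D :=
    mul_le_mul_of_nonneg_left (by linarith) hLc0
  have hL : (Lc + 3 * Lp + 1) * D = Lc * D + 3 * (Lp * D) + D := by ring
  have hφ1 := abs_mul_sub_mul_le hφg (hf1.1 j) hφ (abs_sub_le_l1Dist (f1 s) (g1 s') j)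
  rw [hL]
  refine ⟨?_, ?_, ?_⟩
  · have hx := abs_mul_sub_mul_le (hΦ.1 (∑ k, gbar1 s' k) (rhoF_mem hgb1) _ (rhoF_mem hg1))
      (hfb1.1 j)
      (le_refl |Φ (∑ k, gbar1 s' k) (rhoF (g1 s')) - Φ (∑ k, fbar1 s k) (rhoF (f1 s))|)
      (abs_sub_le_l1Dist (fbar1 s) (gbar1 s') j)
    exact (hLc j _ _ hf1 hg1 _ (hv.mem_Icc j) _ _ _ _).trans (by linarith)
  · have hx := abs_mul_sub_mul_le (hΦ.1 (∑ k, gbar2 s' k) (rhoF_mem hgb2) _ (rhoF_mem hg2))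
      (hfb2.1 j)
      (le_refl |Φ (∑ k, gbar2 s' k) (rhoF (g2 s')) - Φ (∑ k, fbar2 s k) (rhoF (f2 s))|)
      (abs_sub_le_l1Dist (fbar2 s) (gbar2 s') j)
    have hy := abs_mul_sub_mul_le (unitInterval.mul_mem hhg hφg) (hf2.1 j)
      (abs_mul_sub_mul_le hhg hφf hh hφ) (abs_sub_le_l1Dist (f2 s) (g2 s') j)
    exact (hLc j _ _ hf2 hg2 _ (hv.mem_Icc j) _ _ _ _).trans (by linarith)
  · have hφ2 := abs_mul_sub_mul_le hφg (unitInterval.mul_mem hhf (hf2.1 j)) hφ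
      (abs_mul_sub_mul_le hhg (hf2.1 j) hh (abs_sub_le_l1Dist (f2 s) (g2 s') j))
    have hx : |phi301 v Φ H p g1 g2 g3 s' * (g1 s' j + hcoef v H p g1 g2 s' * g2 s' j) * deltaC j
        - phi301 v Φ H p f1 f2 f3 s * (f1 s j + hcoef v H p f1 f2 s * f2 s j) * deltaC j|
        ≤ 3 * (Lp * D) + l1Dist (f1 s) (g1 s') + l1Dist (f2 s) (g2 s') := by
      rw [← sub_mul, mul_comm]
      refine (abs_deltaC_mul_le j _).trans ?_
      rw [mul_add, mul_add, add_sub_add_comm]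
      exact (abs_add_le _ _).trans (by linarith)
    have hy := abs_mul_sub_mul_le hΦg (hf3.1 j) (le_refl |Φg s' - Φf s|)
      (abs_sub_le_l1Dist (f3 s) (g3 s') j)
    exact (hLc j _ _ hf3 hg3 _ (hv.mem_Icc j) _ _ _ _).trans (by linarith)

lemma IsFluxLimiter.continuousOn {Φ : ℝ → ℝ → ℝ} (hΦ : IsFluxLimiter Φ) {a b : ℝ → ℝ} {S : Set ℝ}
    (ha : ContinuousOn a S) (hb : ContinuousOn b S) (ha' : ∀ s ∈ S, a s ∈ Icc (0 : ℝ) 1)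
    (hb' : ∀ s ∈ S, b s ∈ Icc (0 : ℝ) 1) : ContinuousOn (fun s => Φ (a s) (b s)) S := by
  obtain ⟨K, -, hK⟩ := hΦ.2.2
  refine continuousOn_of_abs_sub_le (fun s s' => K * (|a s' - a s| + |b s' - b s|))
    (fun s _ => by fun_prop) (fun s _ => by simp)
    fun s hs s' hs' => hK _ (ha' s hs) _ (hb' s hs) _ (ha' s' hs') _ (hb' s' hs')

lemma continuousOn_rhoF {n : ℕ} {f : ℝ → Fin n → ℝ} {S : Set ℝ} (hf : ContinuousOn f S) :
    ContinuousOn (fun s => rhoF (f s)) S := by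
  unfold rhoF
  fun_prop

lemma continuousOn_junctionDist {n : ℕ} {f1 f2 f3 g1 g2 g3 : ℝ → Fin n → ℝ} {S : Set ℝ}
    {σ : ℝ → ℝ} (hf1 : ContinuousOn (fun s => f1 (σ s)) S)
    (hf2 : ContinuousOn (fun s => f2 (σ s)) S) (hf3 : ContinuousOn (fun s => f3 (σ s)) S)
    (hg1 : ContinuousOn g1 S) (hg2 : ContinuousOn g2 S) (hg3 : ContinuousOn g3 S) :
    ContinuousOn (fun s => junctionDist f1 f2 f3 g1 g2 g3 (σ s) s) S :=
  ((hf1.l1Dist hg1).add (hf2.l1Dist hg2)).add (hf3.l1Dist hg3)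

lemma continuousOn_boundaryDist {n : ℕ} {Φ : ℝ → ℝ → ℝ}
    {fbar1 fbar2 f1 f2 gbar1 gbar2 g1 g2 : ℝ → Fin n → ℝ} {Φbar3f Φbar3g : ℝ → ℝ} {S : Set ℝ}
    {σ : ℝ → ℝ} (hfb1 : ContinuousOn (fun s => fbar1 (σ s)) S)
    (hfb2 : ContinuousOn (fun s => fbar2 (σ s)) S)
    (hΦf1 : ContinuousOn (fun s => Φ (∑ k, fbar1 (σ s) k) (rhoF (f1 (σ s)))) S)
    (hΦf2 : ContinuousOn (fun s => Φ (∑ k, fbar2 (σ s) k) (rhoF (f2 (σ s)))) S)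
    (hΦf3 : ContinuousOn (fun s => Φbar3f (σ s)) S)
    (hgb1 : ContinuousOn gbar1 S) (hgb2 : ContinuousOn gbar2 S)
    (hΦg1 : ContinuousOn (fun s => Φ (∑ k, gbar1 s k) (rhoF (g1 s))) S)
    (hΦg2 : ContinuousOn (fun s => Φ (∑ k, gbar2 s k) (rhoF (g2 s))) S)
    (hΦg3 : ContinuousOn Φbar3g S) :
    ContinuousOn (fun s =>
      boundaryDist Φ fbar1 fbar2 f1 f2 Φbar3f gbar1 gbar2 g1 g2 Φbar3g (σ s) s) S :=
  (((((hΦg1.sub hΦf1).abs).add (hΦg2.sub hΦf2).abs).add (hΦg3.sub hΦf3).abs).add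
    (hfb1.l1Dist hgb1)).add (hfb2.l1Dist hgb2)

/-- The incoming flux limiters and the right-hand sides along a solution depend continuously on
time. -/
lemma IsMildSol21.continuousOn_rhs {n : ℕ} {hn : 2 ≤ n} {v : Fin n → ℝ}
    (hv : IsSpeedLattice hn v) {η0 : ℝ} (hη0 : 0 ≤ η0) {A : Fin n → Fin n → Fin n → ℝ → ℝ}
    (hA : IsTableOfGames A) {Φ : ℝ → ℝ → ℝ} (hΦ : IsFluxLimiter Φ) {ε : ℝ} {H : ℝ → ℝ}
    (hH : IsRegularizer ε H) {p : ℝ} (hp0 : 0 < p)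
    (hpv : ∀ k : Fin n, (k : ℕ) ≠ 0 → p ≤ v k) {T : ℝ}
    {φ1 φ2 φ3 : Fin n → ℝ} {fbar1 fbar2 f1 f2 f3 : ℝ → Fin n → ℝ} {Φbar3 : ℝ → ℝ}
    (hdata : GoodData21 T φ1 φ2 φ3 fbar1 fbar2 Φbar3)
    (hF : IsMildSol21 v η0 A Φ H p T φ1 φ2 φ3 fbar1 fbar2 Φbar3 f1 f2 f3) :
    (ContinuousOn (fun s => Φ (∑ k, fbar1 s k) (rhoF (f1 s))) (Icc 0 T) ∧
      ContinuousOn (fun s => Φ (∑ k, fbar2 s k) (rhoF (f2 s))) (Icc 0 T)) ∧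
    ∀ j, ContinuousOn (rhs21_1 v η0 A Φ H p fbar1 f1 f2 f3 j) (Icc 0 T) ∧
      ContinuousOn (rhs21_2 v η0 A Φ H p fbar2 f1 f2 f3 j) (Icc 0 T) ∧
      ContinuousOn (rhs21_3 v η0 A Φ H p Φbar3 f1 f2 f3 j) (Icc 0 T) := by
  obtain ⟨-, -, -, hcb1, hb1, hcb2, hb2, hcΦ3, hΦ3⟩ := hdata
  obtain ⟨hc1, hc2, hc3, hadm, -⟩ := hF
  obtain ⟨L, -, hL⟩ := exists_abs_rhs21_sub_le hv hη0 hA hΦ hH hp0 hpv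
  have hcΦ1 : ContinuousOn (fun s => Φ (∑ k, fbar1 s k) (rhoF (f1 s))) (Icc 0 T) :=
    hΦ.continuousOn (continuousOn_rhoF hcb1) (continuousOn_rhoF hc1)
      (fun s hs => rhoF_mem (hb1 s hs)) fun s hs => rhoF_mem (hadm s hs).1
  have hcΦ2 : ContinuousOn (fun s => Φ (∑ k, fbar2 s k) (rhoF (f2 s))) (Icc 0 T) :=
    hΦ.continuousOn (continuousOn_rhoF hcb2) (continuousOn_rhoF hc2)
      (fun s hs => rhoF_mem (hb2 s hs)) fun s hs => rhoF_mem (hadm s hs).2.1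
  refine ⟨⟨hcΦ1, hcΦ2⟩, fun j => ?_⟩
  have hm : ∀ s ∈ Icc 0 T, ContinuousOn (fun s' => L * junctionDist f1 f2 f3 f1 f2 f3 s s'
      + boundaryDist Φ fbar1 fbar2 f1 f2 Φbar3 fbar1 fbar2 f1 f2 Φbar3 s s') (Icc 0 T) :=
    fun s _ => (continuousOn_const.mul (continuousOn_junctionDist (σ := fun _ => s)
      continuousOn_const continuousOn_const continuousOn_const hc1 hc2 hc3)).add
      (continuousOn_boundaryDist (σ := fun _ => s) continuousOn_const continuousOn_const
        continuousOn_const continuousOn_const continuousOn_const hcb1 hcb2 hcΦ1 hcΦ2 hcΦ3)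
  have hm0 : ∀ s ∈ Icc 0 T, L * junctionDist f1 f2 f3 f1 f2 f3 s s
      + boundaryDist Φ fbar1 fbar2 f1 f2 Φbar3 fbar1 fbar2 f1 f2 Φbar3 s s = 0 :=
    fun s _ => by simp [junctionDist, boundaryDist, l1Dist_self]
  have hle := fun s (hs : s ∈ Icc 0 T) s' (hs' : s' ∈ Icc 0 T) =>
    hL fbar1 fbar2 f1 f2 f3 fbar1 fbar2 f1 f2 f3 Φbar3 Φbar3 s s' j
      (hadm s hs).1 (hadm s hs).2.1 (hadm s hs).2.2 (hadm s' hs').1 (hadm s' hs').2.1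
      (hadm s' hs').2.2 (hb1 s hs) (hb2 s hs) (hb1 s' hs') (hb2 s' hs') (hΦ3 s' hs')
  exact ⟨continuousOn_of_abs_sub_le _ hm hm0 fun s hs s' hs' => (hle s hs s' hs').1,
    continuousOn_of_abs_sub_le _ hm hm0 fun s hs s' hs' => (hle s hs s' hs').2.1,
    continuousOn_of_abs_sub_le _ hm hm0 fun s hs s' hs' => (hle s hs s' hs').2.2⟩

/-- Continuous dependence for the regularized 2-1 junction. -/
theorem continuous_dependence_two_one_junction
    {n : ℕ} (hn : 2 ≤ n) (v : Fin n → ℝ) (hv : IsSpeedLattice hn v)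
    (η0 : ℝ) (hη0 : 0 < η0)
    (A : Fin n → Fin n → Fin n → ℝ → ℝ) (hA : IsTableOfGames A)
    (Φ : ℝ → ℝ → ℝ) (hΦ : IsFluxLimiter Φ)
    (ε : ℝ) (hε : 0 < ε) (H : ℝ → ℝ) (hH : IsRegularizer ε H)
    (p : ℝ) (hp0 : 0 < p) (hpv : p ≤ v ⟨1, by omega⟩)
    (T : ℝ) (hT : 0 < T)
    (φ1 φ2 φ3 ψ1 ψ2 ψ3 : Fin n → ℝ)
    (fbar1 fbar2 gbar1 gbar2 : ℝ → Fin n → ℝ) (Φbar3f Φbar3g : ℝ → ℝ)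
    (hdataf : GoodData21 T φ1 φ2 φ3 fbar1 fbar2 Φbar3f)
    (hdatag : GoodData21 T ψ1 ψ2 ψ3 gbar1 gbar2 Φbar3g)
    (f1 f2 f3 g1 g2 g3 : ℝ → Fin n → ℝ)
    (hF : IsMildSol21 v η0 A Φ H p T φ1 φ2 φ3 fbar1 fbar2 Φbar3f f1 f2 f3)
    (hG : IsMildSol21 v η0 A Φ H p T ψ1 ψ2 ψ3 gbar1 gbar2 Φbar3g g1 g2 g3) :
    ∃ C : ℝ, 0 < C ∧ ∀ t ∈ Icc (0:ℝ) T,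
      (∑ j, |g1 t j - f1 t j|) + (∑ j, |g2 t j - f2 t j|) + (∑ j, |g3 t j - f3 t j|)
        ≤ C * ((∑ j, |ψ1 j - φ1 j|) + (∑ j, |ψ2 j - φ2 j|) + (∑ j, |ψ3 j - φ3 j|)
          + ∫ s in (0:ℝ)..T,
              (|Φ (∑ k, gbar1 s k) (rhoF (g1 s)) - Φ (∑ k, fbar1 s k) (rhoF (f1 s))|
                + |Φ (∑ k, gbar2 s k) (rhoF (g2 s)) - Φ (∑ k, fbar2 s k) (rhoF (f2 s))|
                + |Φbar3g s - Φbar3f s|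
                + (∑ j, |gbar1 s j - fbar1 s j|) + (∑ j, |gbar2 s j - fbar2 s j|))) := by
  have hpk : ∀ k : Fin n, (k : ℕ) ≠ 0 → p ≤ v k := fun k hk =>
    hpv.trans (hv.1.monotone (Fin.le_def.2 (Nat.one_le_iff_ne_zero.2 hk)))
  obtain ⟨L, hL0, hL⟩ := exists_abs_rhs21_sub_le hv hη0.le hA hΦ hH hp0 hpk
  obtain ⟨⟨hΦf1, hΦf2⟩, hRf⟩ := hF.continuousOn_rhs hv hη0.le hA hΦ hH hp0 hpk hdataf
  obtain ⟨⟨hΦg1, hΦg2⟩, hRg⟩ := hG.continuousOn_rhs hv hη0.le hA hΦ hH hp0 hpk hdatag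
  obtain ⟨-, -, -, hcfb1, hfb1, hcfb2, hfb2, hcΦf, -⟩ := hdataf
  obtain ⟨-, -, -, hcgb1, hgb1, hcgb2, hgb2, hcΦg, hΦg⟩ := hdatag
  obtain ⟨hcf1, hcf2, hcf3, hadmf, hf1, hf2, hf3⟩ := hF
  obtain ⟨hcg1, hcg2, hcg3, hadmg, hg1, hg2, hg3⟩ := hG
  set D : ℝ → ℝ := fun s => junctionDist f1 f2 f3 g1 g2 g3 s s
  set B : ℝ → ℝ := fun s =>
    boundaryDist Φ fbar1 fbar2 f1 f2 Φbar3f gbar1 gbar2 g1 g2 Φbar3g s s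
  have hDc : ContinuousOn D (Icc 0 T) :=
    continuousOn_junctionDist (σ := id) hcf1 hcf2 hcf3 hcg1 hcg2 hcg3
  have hBc : ContinuousOn B (Icc 0 T) :=
    continuousOn_boundaryDist (σ := id) hcfb1 hcfb2 hΦf1 hΦf2 hcΦf hcgb1 hcgb2 hΦg1 hΦg2 hcΦg
  have hD0 : ∀ s, 0 ≤ D s := fun s =>
    add_nonneg (add_nonneg (l1Dist_nonneg _ _) (l1Dist_nonneg _ _)) (l1Dist_nonneg _ _)
  have hB0 : ∀ s, 0 ≤ B s := fun s =>
    add_nonneg (add_nonneg (add_nonneg (add_nonneg (abs_nonneg _) (abs_nonneg _)) (abs_nonneg _))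
      (l1Dist_nonneg _ _)) (l1Dist_nonneg _ _)
  have hsub : ∀ {t}, t ∈ Icc 0 T → uIcc 0 t ⊆ Icc 0 T := fun ht =>
    (uIcc_of_le ht.1).le.trans (Icc_subset_Icc_right ht.2)
  have hE : ContinuousOn (fun s => L * D s + B s) (Icc 0 T) :=
    (continuousOn_const.mul hDc).add hBc
  set I := ∫ s in (0 : ℝ)..T, B s
  have hI0 : 0 ≤ I := intervalIntegral.integral_nonneg hT.le fun s _ => hB0 s
  have hEle : ∀ t ∈ Icc 0 T, ∫ s in (0 : ℝ)..t, (L * D s + B s)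
      ≤ L * (∫ s in (0 : ℝ)..t, D s) + I := fun t ht => by
    rw [intervalIntegral.integral_add
      ((hDc.mono (hsub ht)).intervalIntegrable.const_mul L)
      (hBc.mono (hsub ht)).intervalIntegrable, intervalIntegral.integral_const_mul]
    exact add_le_add_right (intervalIntegral.integral_mono_interval le_rfl ht.1 ht.2
      (Filter.Eventually.of_forall hB0)
      (hBc.mono (hsub (right_mem_Icc.2 hT.le))).intervalIntegrable) _
  have hpt := fun j s (hs : s ∈ Icc 0 T) =>
    hL fbar1 fbar2 f1 f2 f3 gbar1 gbar2 g1 g2 g3 Φbar3f Φbar3g s s j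
      (hadmf s hs).1 (hadmf s hs).2.1 (hadmf s hs).2.2 (hadmg s hs).1 (hadmg s hs).2.1
      (hadmg s hs).2.2 (hfb1 s hs) (hfb2 s hs) (hgb1 s hs) (hgb2 s hs) (hΦg s hs)
  have hsum : ∀ (φ ψ f g : Fin n → ℝ) (e : ℝ), (∀ j, |g j - f j| ≤ |ψ j - φ j| + e) →
      l1Dist f g ≤ l1Dist φ ψ + n * e := fun φ ψ f g e h => by
    have hc : (n : ℝ) * e = ∑ _j : Fin n, e := by simp
    rw [hc, l1Dist, l1Dist, ← Finset.sum_add_distrib]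
    exact Finset.sum_le_sum fun j _ => h j
  set D0 := l1Dist φ1 ψ1 + l1Dist φ2 ψ2 + l1Dist φ3 ψ3
  have hD00 : 0 ≤ D0 :=
    add_nonneg (add_nonneg (l1Dist_nonneg _ _) (l1Dist_nonneg _ _)) (l1Dist_nonneg _ _)
  have hn1 : (2 : ℝ) ≤ n := by exact_mod_cast hn
  have hint : ∀ t ∈ Icc 0 T, D t ≤ 3 * n * (D0 + I) + 3 * n * L * ∫ s in (0 : ℝ)..t, D s := by
    intro t ht
    have h1 := hsum φ1 ψ1 (f1 t) (g1 t) _ fun j => (abs_sub_le_of_integral_eq ht (hf1 t ht j)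
      (hg1 t ht j) (hRf j).1 (hRg j).1 hE fun s hs => (hpt j s hs).1).trans
        (add_le_add_right (hEle t ht) _)
    have h2 := hsum φ2 ψ2 (f2 t) (g2 t) _ fun j => (abs_sub_le_of_integral_eq ht (hf2 t ht j)
      (hg2 t ht j) (hRf j).2.1 (hRg j).2.1 hE fun s hs => (hpt j s hs).2.1).trans
        (add_le_add_right (hEle t ht) _)
    have h3 := hsum φ3 ψ3 (f3 t) (g3 t) _ fun j => (abs_sub_le_of_integral_eq ht (hf3 t ht j)
      (hg3 t ht j) (hRf j).2.2 (hRg j).2.2 hE fun s hs => (hpt j s hs).2.2).trans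
        (add_le_add_right (hEle t ht) _)
    have hDt : D t = l1Dist (f1 t) (g1 t) + l1Dist (f2 t) (g2 t) + l1Dist (f3 t) (g3 t) := rfl
    have hle : D0 ≤ 3 * n * D0 := le_mul_of_one_le_left hD00 (by linarith)
    linarith
  have hL3 : 0 < 3 * n * L := by positivity
  refine ⟨3 * n * Real.exp (3 * n * L * T), by positivity, fun t ht => ?_⟩
  have hexp : Real.exp (3 * n * L * t) ≤ Real.exp (3 * n * L * T) :=
    Real.exp_le_exp.2 (mul_le_mul_of_nonneg_left ht.2 hL3.le)
  calc D t ≤ 3 * n * (D0 + I) * Real.exp (3 * n * L * t) :=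
        gronwall_integral hL3 hDc (fun s _ => hD0 s) hint t ht
    _ ≤ 3 * n * (D0 + I) * Real.exp (3 * n * L * T) :=
        mul_le_mul_of_nonneg_left hexp (by positivity)
    _ = 3 * n * Real.exp (3 * n * L * T) * (D0 + I) := by ring
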